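/- The quotient abelian group 𝔏̄₃ = 𝔏₃/(⟨⟨ω⟩⟩ ∩ 𝔏₃) is torsion-free. -/

import Mathlib

open scoped TensorProduct

noncomputable section

/-- The free Lie ring `𝔏` on the `2g` generators. -/
abbrev L (g : ℕ) : Type := FreeLieAlgebra ℤ (Fin (2 * g))

/-- The free abelian group `H` of rank `2g`. -/
abbrev H (g : ℕ) : Type := Fin (2 * g) → ℤ

/-- The canonical inclusion of `H` into `𝔏` as the degree `1` part. -/
def toL (g : ℕ) : H g →ₗ[ℤ] L g where
  toFun v := ∑ i, v i • FreeLieAlgebra.of ℤ i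
  map_add' x y := by simp [add_smul, Finset.sum_add_distrib]
  map_smul' c x := by simp [Finset.smul_sum, smul_smul]

/-- Index of the basis element `aᵢ`. -/
def aIdx (g : ℕ) (i : Fin g) : Fin (2 * g) := ⟨i.1, by have := i.2; omega⟩

/-- Index of the basis element `bᵢ`. -/
def bIdx (g : ℕ) (i : Fin g) : Fin (2 * g) := ⟨g + i.1, by have := i.2; omega⟩

/-- The basis element `aᵢ` of `H`. -/
def aV (g : ℕ) (i : Fin g) : H g := Pi.single (aIdx g i) 1

/-- The basis element `bᵢ` of `H`. -/
def bV (g : ℕ) (i : Fin g) : H g := Pi.single (bIdx g i) 1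

/-- The symplectic pairing `ω : H × H → ℤ`, with `ω(aᵢ,bⱼ) = δᵢⱼ`, `ω(aᵢ,aⱼ) = ω(bᵢ,bⱼ) = 0`. -/
def omegaPair (g : ℕ) (x y : H g) : ℤ :=
  ∑ i : Fin g, (x (aIdx g i) * y (bIdx g i) - x (bIdx g i) * y (aIdx g i))

/-- `IsBrkt g k x` means that `x` is a `k`-fold Lie bracket of elements of `H`. -/
inductive IsBrkt (g : ℕ) : ℕ → L g → Prop
  | of (v : H g) : IsBrkt g 1 (toL g v)
  | lie {m n : ℕ} {x y : L g} : IsBrkt g m x → IsBrkt g n y → IsBrkt g (m + n) ⁅x, y⁆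

/-- `𝔏ₖ`, the degree-`k` homogeneous component of the free Lie ring:
the `ℤ`-span of all `k`-fold Lie brackets of elements of `H`. -/
def homog (g k : ℕ) : Submodule ℤ (L g) := Submodule.span ℤ {x | IsBrkt g k x}

lemma toL_mem (g : ℕ) (v : H g) : toL g v ∈ homog g 1 :=
  Submodule.subset_span (IsBrkt.of v)

lemma lie_mem_homog {g m n : ℕ} {x y : L g} (hx : x ∈ homog g m) (hy : y ∈ homog g n) :
    ⁅x, y⁆ ∈ homog g (m + n) := by
  induction hx using Submodule.span_induction with
  | mem a ha =>
    induction hy using Submodule.span_induction with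
    | mem b hb => exact Submodule.subset_span (ha.lie hb)
    | zero => simp
    | add b c hb hc ihb ihc => rw [lie_add]; exact Submodule.add_mem _ ihb ihc
    | smul t b hb ihb => rw [lie_smul]; exact Submodule.smul_mem _ t ihb
  | zero => simp
  | add a c ha hc iha ihc => rw [add_lie]; exact Submodule.add_mem _ iha ihc
  | smul t a ha iha => rw [smul_lie]; exact Submodule.smul_mem _ t iha

/-- `[[a,b],c]` as an element of `𝔏₃`. -/
def trip (g : ℕ) (a b c : H g) : ↥(homog g 3) :=
  ⟨⁅⁅toL g a, toL g b⁆, toL g c⁆,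
    Submodule.subset_span (((IsBrkt.of a).lie (IsBrkt.of b)).lie (IsBrkt.of c))⟩

/-- The symplectic element `ω = Σᵢ [aᵢ, bᵢ] ∈ 𝔏₂`. -/
def omegaL (g : ℕ) : L g := ∑ i : Fin g, ⁅toL g (aV g i), toL g (bV g i)⁆

lemma omegaL_mem (g : ℕ) : omegaL g ∈ homog g 2 :=
  Submodule.sum_mem _ fun i _ =>
    Submodule.subset_span ((IsBrkt.of (aV g i)).lie (IsBrkt.of (bV g i)))

/-- The Lie ideal `⟨⟨ω⟩⟩` of `𝔏` generated by `ω`. -/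
def omegaIdeal (g : ℕ) : LieIdeal ℤ (L g) := LieSubmodule.lieSpan ℤ (L g) {omegaL g}

end

noncomputable section

/-- The submodule `⟨⟨ω⟩⟩ ∩ 𝔏ₖ`, viewed inside `𝔏ₖ`. -/
def Jsub (g k : ℕ) : Submodule ℤ ↥(homog g k) :=
  Submodule.comap (homog g k).subtype (omegaIdeal g).toSubmodule

/-- `𝔏̄ₖ = 𝔏ₖ / (⟨⟨ω⟩⟩ ∩ 𝔏ₖ)`. -/
abbrev Lbar (g k : ℕ) : Type := ↥(homog g k) ⧸ Jsub g k

/-- Truncated (degree at most 3) nonunital tensor algebra, as a Lie ring. -/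
@[ext] structure NT (X : Type) where
  c1 : X → ℤ
  c2 : X → X → ℤ
  c3 : X → X → X → ℤ

namespace NT
variable {X : Type}

instance : Zero (NT X) := ⟨⟨0, 0, 0⟩⟩
instance : Add (NT X) := ⟨fun a b => ⟨a.c1 + b.c1, a.c2 + b.c2, a.c3 + b.c3⟩⟩
instance : Neg (NT X) := ⟨fun a => ⟨-a.c1, -a.c2, -a.c3⟩⟩
instance : Bracket (NT X) (NT X) := ⟨fun a b => ⟨0,
  fun i j => a.c1 i * b.c1 j - b.c1 i * a.c1 j,
  fun i j k => a.c2 i j * b.c1 k + a.c1 i * b.c2 j k - b.c2 i j * a.c1 k - b.c1 i * a.c2 j k⟩⟩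

@[simp] lemma zero1 : (0 : NT X).c1 = 0 := rfl
@[simp] lemma zero2 : (0 : NT X).c2 = 0 := rfl
@[simp] lemma zero3 : (0 : NT X).c3 = 0 := rfl
@[simp] lemma add1 (a b : NT X) : (a + b).c1 = a.c1 + b.c1 := rfl
@[simp] lemma add2 (a b : NT X) : (a + b).c2 = a.c2 + b.c2 := rfl
@[simp] lemma add3 (a b : NT X) : (a + b).c3 = a.c3 + b.c3 := rfl
@[simp] lemma neg1 (a : NT X) : (-a).c1 = -a.c1 := rfl
@[simp] lemma neg2 (a : NT X) : (-a).c2 = -a.c2 := rfl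
@[simp] lemma neg3 (a : NT X) : (-a).c3 = -a.c3 := rfl
@[simp] lemma lie1 (a b : NT X) : (⁅a, b⁆ : NT X).c1 = 0 := rfl
@[simp] lemma lie2 (a b : NT X) (i j : X) :
    (⁅a, b⁆ : NT X).c2 i j = a.c1 i * b.c1 j - b.c1 i * a.c1 j := rfl
@[simp] lemma lie3 (a b : NT X) (i j k : X) :
    (⁅a, b⁆ : NT X).c3 i j k = a.c2 i j * b.c1 k + a.c1 i * b.c2 j k
      - b.c2 i j * a.c1 k - b.c1 i * a.c2 j k := rfl

instance : AddCommGroup (NT X) where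
  add_assoc a b c := by ext <;> simp [add_assoc]
  zero_add a := by ext <;> simp
  add_zero a := by ext <;> simp
  add_comm a b := by ext <;> simp [add_comm]
  neg_add_cancel a := by ext <;> simp
  nsmul := nsmulRec
  zsmul := zsmulRec

instance : LieRing (NT X) where
  add_lie a b c := by ext <;> simp <;> ring
  lie_add a b c := by ext <;> simp <;> ring
  lie_self a := by ext <;> simp <;> ring
  leibniz_lie a b c := by ext <;> simp <;> ring

/-- The components as additive maps. -/
def p1 : NT X →ₗ[ℤ] (X → ℤ) := AddMonoidHom.toIntLinearMap ⟨⟨c1, rfl⟩, fun _ _ => rfl⟩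
def p2 : NT X →ₗ[ℤ] (X → X → ℤ) := AddMonoidHom.toIntLinearMap ⟨⟨c2, rfl⟩, fun _ _ => rfl⟩
def p3 : NT X →ₗ[ℤ] (X → X → X → ℤ) := AddMonoidHom.toIntLinearMap ⟨⟨c3, rfl⟩, fun _ _ => rfl⟩

lemma smul1 (t : ℤ) (a : NT X) : (t • a).c1 = t • a.c1 := map_smul p1 t a
lemma smul2 (t : ℤ) (a : NT X) : (t • a).c2 = t • a.c2 := map_smul p2 t a
lemma smul3 (t : ℤ) (a : NT X) : (t • a).c3 = t • a.c3 := map_smul p3 t a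
lemma sum1 {ι : Type} (s : Finset ι) (f : ι → NT X) : (∑ i ∈ s, f i).c1 = ∑ i ∈ s, (f i).c1 :=
  map_sum p1 f s
lemma sum2 {ι : Type} (s : Finset ι) (f : ι → NT X) : (∑ i ∈ s, f i).c2 = ∑ i ∈ s, (f i).c2 :=
  map_sum p2 f s
lemma sum3 {ι : Type} (s : Finset ι) (f : ι → NT X) : (∑ i ∈ s, f i).c3 = ∑ i ∈ s, (f i).c3 :=
  map_sum p3 f s

end NT

/-- The map from the free Lie ring to the truncated tensor algebra. -/
def phi (g : ℕ) : L g →ₗ⁅ℤ⁆ NT (Fin (2 * g)) :=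
  FreeLieAlgebra.lift ℤ fun i => ⟨Pi.single i 1, 0, 0⟩

/-- Generators. -/
abbrev gen (g : ℕ) (i : Fin (2 * g)) : L g := FreeLieAlgebra.of ℤ i

lemma phi_gen (g : ℕ) (i : Fin (2 * g)) : phi g (gen g i) = ⟨Pi.single i 1, 0, 0⟩ := by
  exact FreeLieAlgebra.lift_of_apply _ _

lemma phi_toL (g : ℕ) (v : H g) : phi g (toL g v) = ⟨v, 0, 0⟩ := by
  have : toL g v = ∑ i, v i • gen g i := rfl
  rw [this, map_sum]
  simp only [map_smul, phi_gen]
  ext i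
  · simp [NT.sum1, NT.smul1, Pi.single_apply]
  · simp [NT.sum2, NT.smul2]
  · simp [NT.sum3, NT.smul3]

lemma toL_single (g : ℕ) (i : Fin (2 * g)) : toL g (Pi.single i 1) = gen g i := by
  have : toL g (Pi.single i 1) = ∑ j, (Pi.single i 1 : H g) j • gen g j := rfl
  rw [this, Finset.sum_eq_single i] <;> simp +contextual [Pi.single_apply]

/-- The matrix of omega. -/
def om (g : ℕ) (p q : Fin (2 * g)) : ℤ :=
  ∑ i : Fin g, ((if p = aIdx g i then 1 else 0) * (if q = bIdx g i then 1 else 0)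
    - (if p = bIdx g i then 1 else 0) * (if q = aIdx g i then 1 else 0))

lemma phi_omega (g : ℕ) : phi g (omegaL g) = ⟨0, om g, 0⟩ := by
  simp only [omegaL, map_sum, LieHom.map_lie, phi_toL]
  ext i j k
  · simp [NT.sum1]
  · simp [NT.sum2, om, aV, bV, Pi.single_apply]
  · simp [NT.sum3]

lemma aIdx_inj {g : ℕ} {i j : Fin g} : aIdx g i = aIdx g j ↔ i = j := by
  simp [aIdx, Fin.ext_iff]
lemma bIdx_inj {g : ℕ} {i j : Fin g} : bIdx g i = bIdx g j ↔ i = j := by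
  simp [bIdx, Fin.ext_iff]
lemma aIdx_ne {g : ℕ} {i j : Fin g} : aIdx g i ≠ bIdx g j := by
  have := i.2
  simp [aIdx, bIdx]; omega
lemma bIdx_ne {g : ℕ} {i j : Fin g} : bIdx g j ≠ aIdx g i := aIdx_ne.symm

lemma om_ba (g : ℕ) (i : Fin g) : om g (bIdx g i) (aIdx g i) = -1 := by
  simp [om, aIdx_inj, bIdx_inj, aIdx_ne, bIdx_ne]
lemma om_bb (g : ℕ) (i : Fin g) : om g (bIdx g i) (bIdx g i) = 0 := by
  simp [om, aIdx_inj, bIdx_inj, aIdx_ne, bIdx_ne]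
lemma om_a (g : ℕ) (i : Fin g) (z) (hz : z ≠ bIdx g i) : om g (aIdx g i) z = 0 := by
  refine Finset.sum_eq_zero fun j _ => ?_
  by_cases hj : i = j
  · subst hj; simp [aIdx_ne, hz]
  · simp [aIdx_inj, aIdx_ne, hj]

/-- `[ω, v]` in degree 3. -/
def omv (g : ℕ) (v : H g) : Fin (2 * g) → Fin (2 * g) → Fin (2 * g) → ℤ :=
  fun i j k => om g i j * v k - v i * om g j k

lemma omv_add (g : ℕ) (v w : H g) : omv g (v + w) = omv g v + omv g w := by
  ext i j k; simp [omv]; ring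
lemma omv_smul (g : ℕ) (t : ℤ) (v : H g) : omv g (t • v) = t • omv g v := by
  ext i j k; simp [omv]; ring

lemma phi_lie_omega (g : ℕ) (v : H g) : phi g ⁅omegaL g, toL g v⁆ = ⟨0, 0, omv g v⟩ := by
  rw [LieHom.map_lie, phi_omega, phi_toL]
  ext i j k <;> simp [omv]

/-- The retraction. -/
def retr (g : ℕ) (i : Fin g) (B : Fin (2 * g) → Fin (2 * g) → Fin (2 * g) → ℤ) : H g :=
  fun z => if z = bIdx g i then B (bIdx g i) (bIdx g i) (aIdx g i)
    else - B (bIdx g i) (aIdx g i) z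

lemma retr_omv (g : ℕ) (i : Fin g) (v : H g) : retr g i (omv g v) = v := by
  ext z
  by_cases hz : z = bIdx g i
  · simp [retr, omv, hz, om_ba, om_bb]
  · simp [retr, omv, hz, om_ba, om_a]

lemma retr_smul (g : ℕ) (i : Fin g) (n : ℤ) (B) : retr g i (n • B) = n • retr g i B := by
  ext z
  simp only [retr, Pi.smul_apply, smul_eq_mul]; split_ifs <;> ring

/-- The ideal of elements whose image looks like `c ω + [ω, v]`. -/
def KI (g : ℕ) : LieIdeal ℤ (L g) where
  carrier := {y | ∃ (c : ℤ) (v : H g), phi g y = ⟨0, c • om g, omv g v⟩}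
  zero_mem' := ⟨0, 0, by simp only [map_zero]; ext <;> simp [omv]⟩
  add_mem' := by
    rintro x y ⟨c, v, h⟩ ⟨d, w, h'⟩
    refine ⟨c + d, v + w, ?_⟩
    rw [map_add, h, h', omv_add]
    ext <;> simp; ring
  smul_mem' := by
    rintro t x ⟨c, v, h⟩
    refine ⟨t * c, t • v, ?_⟩
    rw [map_smul, h, omv_smul]
    ext <;> simp [NT.smul1, NT.smul2, NT.smul3, mul_assoc]
  lie_mem := by
    rintro x y ⟨c, v, h⟩
    refine ⟨0, -(c • (phi g x).c1), ?_⟩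
    rw [LieHom.map_lie, h]
    ext <;> simp [omv]; ring

lemma mem_KI {g : ℕ} {y : L g} :
    y ∈ KI g ↔ ∃ (c : ℤ) (v : H g), phi g y = ⟨0, c • om g, omv g v⟩ := Iff.rfl

lemma omegaIdeal_le (g : ℕ) : omegaIdeal g ≤ KI g := by
  rw [omegaIdeal, LieSubmodule.lieSpan_le, Set.singleton_subset_iff]
  exact ⟨1, 0, by rw [phi_omega]; ext <;> simp [omv]⟩

/-- Spans of letter brackets. -/
def S1 (g : ℕ) : Submodule ℤ (L g) := Submodule.span ℤ (Set.range (gen g))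
def S2 (g : ℕ) : Submodule ℤ (L g) :=
  Submodule.span ℤ (Set.range fun p : Fin (2 * g) × Fin (2 * g) => ⁅gen g p.1, gen g p.2⁆)

/-- Hall triples. -/
abbrev HT (g : ℕ) : Type :=
  {p : Fin (2 * g) × Fin (2 * g) × Fin (2 * g) // p.1 < p.2.1 ∧ p.1 ≤ p.2.2}

/-- Hall element. -/
def hall (g : ℕ) (p : HT g) : L g := ⁅⁅gen g p.1.2.1, gen g p.1.1⁆, gen g p.1.2.2⁆

def S3 (g : ℕ) : Submodule ℤ (L g) := Submodule.span ℤ (Set.range (hall g))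

lemma lie_span_mem {g : ℕ} {A B : Set (L g)} {C : Submodule ℤ (L g)}
    (h : ∀ a ∈ A, ∀ b ∈ B, ⁅a, b⁆ ∈ C) {x y : L g} (hx : x ∈ Submodule.span ℤ A)
    (hy : y ∈ Submodule.span ℤ B) : ⁅x, y⁆ ∈ C := by
  induction hx using Submodule.span_induction with
  | mem a ha =>
    induction hy using Submodule.span_induction with
    | mem b hb => exact h a ha b hb
    | zero => simp
    | add b c hb hc ihb ihc => rw [lie_add]; exact Submodule.add_mem _ ihb ihc
    | smul t b hb ihb => rw [lie_smul]; exact Submodule.smul_mem _ t ihb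
  | zero => simp
  | add a c ha hc iha ihc => rw [add_lie]; exact Submodule.add_mem _ iha ihc
  | smul t a ha iha => rw [smul_lie]; exact Submodule.smul_mem _ t iha

lemma toL_S1 (g : ℕ) (v : H g) : toL g v ∈ S1 g :=
  Submodule.sum_mem (S1 g) (t := Finset.univ) fun i _ =>
    Submodule.smul_mem (S1 g) (v i) (Submodule.subset_span (Set.mem_range_self i))

lemma trip_mem_of_lt {g : ℕ} {x y : Fin (2 * g)} (z) (h : x < y) :
    ⁅⁅gen g y, gen g x⁆, gen g z⁆ ∈ S3 g := by
  by_cases hz : x ≤ z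
  · exact Submodule.subset_span ⟨⟨(x, y, z), h, hz⟩, rfl⟩
  · push Not at hz
    have e : ⁅⁅gen g y, gen g x⁆, gen g z⁆ =
        ⁅⁅gen g y, gen g z⁆, gen g x⁆ - ⁅⁅gen g x, gen g z⁆, gen g y⁆ := by
      rw [lie_lie (gen g y) (gen g x) (gen g z), ← lie_skew (gen g y) ⁅gen g x, gen g z⁆,
        ← lie_skew (gen g x) ⁅gen g y, gen g z⁆]
      abel
    rw [e]
    exact Submodule.sub_mem _
      (Submodule.subset_span ⟨⟨(z, y, x), hz.trans h, hz.le⟩, rfl⟩)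
      (Submodule.subset_span ⟨⟨(z, x, y), hz, (hz.trans h).le⟩, rfl⟩)

lemma trip_mem {g : ℕ} (x y z : Fin (2 * g)) : ⁅⁅gen g y, gen g x⁆, gen g z⁆ ∈ S3 g := by
  rcases lt_trichotomy x y with h | h | h
  · exact trip_mem_of_lt z h
  · subst h; simp
  · rw [← lie_skew (gen g y) (gen g x), neg_lie]
    exact Submodule.neg_mem _ (trip_mem_of_lt z h)

lemma lie11 {g : ℕ} {x y : L g} (hx : x ∈ S1 g) (hy : y ∈ S1 g) : ⁅x, y⁆ ∈ S2 g := by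
  refine lie_span_mem ?_ hx hy
  rintro _ ⟨i, rfl⟩ _ ⟨j, rfl⟩
  exact Submodule.subset_span ⟨(i, j), rfl⟩

lemma lie21 {g : ℕ} {x y : L g} (hx : x ∈ S2 g) (hy : y ∈ S1 g) : ⁅x, y⁆ ∈ S3 g := by
  refine lie_span_mem ?_ hx hy
  rintro _ ⟨p, rfl⟩ _ ⟨j, rfl⟩
  exact trip_mem _ _ _

lemma brkt_mem {g k : ℕ} {x : L g} (h : IsBrkt g k x) :
    1 ≤ k ∧ (k = 1 → x ∈ S1 g) ∧ (k = 2 → x ∈ S2 g) ∧ (k = 3 → x ∈ S3 g) := by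
  induction h with
  | of v => exact ⟨le_rfl, fun _ => toL_S1 g v, by omega, by omega⟩
  | @lie m n x y _ _ ihx ihy =>
    obtain ⟨hm, hx1, hx2, _⟩ := ihx
    obtain ⟨hn, hy1, hy2, _⟩ := ihy
    refine ⟨by omega, by omega, fun h => lie11 (hx1 (by omega)) (hy1 (by omega)), fun h => ?_⟩
    rcases (by omega : (m = 2 ∧ n = 1) ∨ (m = 1 ∧ n = 2)) with ⟨h1, h2⟩ | ⟨h1, h2⟩
    · exact lie21 (hx2 h1) (hy1 h2)
    · rw [← lie_skew]
      exact Submodule.neg_mem _ (lie21 (hy2 h2) (hx1 h1))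

lemma homog_le (g : ℕ) : homog g 3 ≤ S3 g :=
  Submodule.span_le.2 fun _ hx => (brkt_mem hx).2.2.2 rfl

lemma hall_aux {X : Type} [LinearOrder X] (x y z u v w : X) (h1 : x < y) (h2 : x ≤ z)
    (h3 : u < v) (h4 : u ≤ w) :
    (((if u = y then 1 else 0) * (if v = x then 1 else 0)
        - (if u = x then 1 else 0) * (if v = y then 1 else 0)) * (if w = z then 1 else 0)
      - (if u = z then 1 else 0) * ((if v = y then 1 else 0) * (if w = x then 1 else 0)
        - (if v = x then 1 else 0) * (if w = y then 1 else 0)) : ℤ) =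
    if x = u ∧ y = v ∧ z = w then (if u = w then -2 else -1) else 0 := by
  by_cases hx : v = x
  · subst hx
    have a1 : u ≠ y := (h3.trans h1).ne
    have a2 : u ≠ z := (h3.trans_le h2).ne
    have a3 : v ≠ u := h3.ne'
    simp [a1, a2, a3, a3.symm]
  · by_cases hy : v = y
    · subst hy
      by_cases hu : u = x
      · subst hu
        by_cases hw : w = z
        · subst hw
          by_cases e : u = w
          · subst e; simp [hx]
          · simp [hx, e]
        · have : ¬ (u = z ∧ w = u) := fun h => hw (h.2.trans h.1)
          by_cases e : u = z
          · have e' : w ≠ u := fun h => this ⟨e, h⟩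
            simp [hx, hw, e', Ne.symm hw]
          · simp [hx, hw, e, Ne.symm hw]
      · have : ¬ (u = z ∧ w = x) := by
          rintro ⟨rfl, rfl⟩
          exact hu (le_antisymm h4 h2)
        by_cases e : u = z
        · have e' : w ≠ x := fun h => this ⟨e, h⟩
          simp [hx, hu, e', Ne.symm hu]
        · simp [hx, hu, e, Ne.symm hu]
    · simp [hx, hy, Ne.symm hy]

lemma phi_hall3 (g : ℕ) (p q : HT g) :
    (phi g (hall g p)).c3 q.1.1 q.1.2.1 q.1.2.2 =
      if p = q then (if q.1.1 = q.1.2.2 then -2 else -1) else 0 := by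
  obtain ⟨⟨x, y, z⟩, h1, h2⟩ := p
  obtain ⟨⟨u, v, w⟩, h3, h4⟩ := q
  simp only at h1 h2 h3 h4
  have e : (phi g (hall g ⟨(x, y, z), h1, h2⟩)).c3 u v w =
      ((if u = y then 1 else 0) * (if v = x then 1 else 0)
        - (if u = x then 1 else 0) * (if v = y then 1 else 0)) * (if w = z then 1 else 0)
      - (if u = z then 1 else 0) * ((if v = y then 1 else 0) * (if w = x then 1 else 0)
        - (if v = x then 1 else 0) * (if w = y then 1 else 0)) := by
    simp only [hall, LieHom.map_lie, phi_gen, NT.lie3, NT.lie2, NT.lie1, Pi.single_apply,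
      Pi.zero_apply]
    ring
  refine e.trans ?_
  simp only [Subtype.mk.injEq, Prod.mk.injEq]
  clear e
  exact hall_aux x y z u v w h1 h2 h3 h4

lemma phi_inj (g : ℕ) (y : L g) (hy : y ∈ homog g 3) (h : (phi g y).c3 = 0) : y = 0 := by
  obtain ⟨c, rfl⟩ := (Submodule.mem_span_range_iff_exists_fun ℤ).1 (homog_le g hy)
  refine Finset.sum_eq_zero fun q _ => ?_
  have := congrFun (congrFun (congrFun h q.1.1) q.1.2.1) q.1.2.2
  simp only [map_sum, map_smul, NT.sum3, NT.smul3, Finset.sum_apply, Pi.smul_apply, phi_hall3,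
    smul_eq_mul, mul_ite, mul_zero, Finset.sum_ite_eq', Finset.mem_univ, if_true,
    Pi.zero_apply] at this
  have : c q = 0 := by split_ifs at this <;> omega
  rw [this, zero_smul]

lemma phi_inj' (g : ℕ) (x y : L g) (hx : x ∈ homog g 3) (hy : y ∈ homog g 3)
    (h : (phi g x).c3 = (phi g y).c3) : x = y := by
  have hs : x + (-1 : ℤ) • y ∈ homog g 3 := (homog g 3).add_mem hx ((homog g 3).smul_mem _ hy)
  have h0 := phi_inj g _ hs (by
    rw [map_add, map_smul, NT.add3, NT.smul3, h, neg_one_smul]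
    exact add_neg_cancel _)
  rwa [neg_one_smul, ← sub_eq_add_neg, sub_eq_zero] at h0

lemma main_aux (g : ℕ) (hg : 1 ≤ g) (y : L g) (hy : y ∈ homog g 3) (n : ℤ) (hn : n ≠ 0)
    (hI : n • y ∈ omegaIdeal g) : y ∈ omegaIdeal g := by
  have hK : ∃ (c : ℤ) (v : H g), phi g (n • y) = ⟨0, c • om g, omv g v⟩ :=
    mem_KI.1 (omegaIdeal_le g hI)
  obtain ⟨c, v, hv⟩ := hK
  have hB : n • (phi g y).c3 = omv g v := by
    rw [map_smul] at hv
    rw [← NT.smul3, hv]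
  obtain ⟨r, hr⟩ : ∃ r, r = retr g ⟨0, hg⟩ (phi g y).c3 := ⟨_, rfl⟩
  have hvr : v = n • r := by
    rw [hr, ← retr_smul, hB, retr_omv]
  have hBr : (phi g y).c3 = omv g r := by
    rw [hvr, omv_smul] at hB
    exact smul_right_injective _ hn hB
  have hmem : ⁅omegaL g, toL g r⁆ ∈ homog g (2 + 1) :=
    lie_mem_homog (omegaL_mem g) (toL_mem g r)
  rw [show 2 + 1 = 3 from rfl] at hmem
  have h0 : y = ⁅omegaL g, toL g r⁆ := by
    apply phi_inj' g y _ hy hmem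
    rw [phi_lie_omega, hBr]
  have hω : omegaL g ∈ omegaIdeal g := LieSubmodule.subset_lieSpan (Set.mem_singleton _)
  rw [h0, ← lie_skew]
  exact (omegaIdeal g).neg_mem ((omegaIdeal g).lie_mem hω)

/-- The quotient group `𝔏̄₃ = 𝔏₃/(⟨⟨ω⟩⟩ ∩ 𝔏₃)` is torsion-free. -/
theorem stmt7 (g : ℕ) (hg : 1 ≤ g) (x : Lbar g 3) (n : ℤ) (hnx : n • x = 0) :
    n = 0 ∨ x = 0 := by
  by_cases hn : n = 0
  · exact Or.inl hn
  right
  obtain ⟨⟨y, hy⟩, rfl⟩ := Submodule.Quotient.mk_surjective _ x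
  rw [← Submodule.Quotient.mk_smul, Submodule.Quotient.mk_eq_zero] at hnx
  rw [Submodule.Quotient.mk_eq_zero]
  exact main_aux g hg y hy n hn hnx

end
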